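/- Let d ≥ 1 and 0 < α < 2. There exists a constant c₃ > 0 depending only on α and d such that for every 0 < t ≤ 1 and every x ∈ ℝ^d, one has k_α^per(t,x) ≥ c₃ t. -/

import Mathlib

open MeasureTheory
open scoped ENNReal

noncomputable section

/-- e^{2π i θ} -/
def fchar (θ : ℝ) : ℂ := Complex.exp (((2 * Real.pi * θ : ℝ) : ℂ) * Complex.I)

/-- periodic fractional heat kernel k_α^per(t,x) = ∑_{n ∈ ℤ^d} e^{-t(2π|n|)^α} e^{2πi n·x} -/
def kper (d : ℕ) (α t : ℝ) (x : Fin d → ℝ) : ℝ :=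
  (∑' n : Fin d → ℤ,
      ((Real.exp (-t * (2 * Real.pi * Real.sqrt (∑ i, (n i : ℝ) ^ 2)) ^ α) : ℝ) : ℂ) *
        fchar (∑ i, (n i : ℝ) * x i)).re


open Filter Topology

lemma norm_fchar (θ : ℝ) : ‖fchar θ‖ = 1 := by
  unfold fchar
  exact Complex.norm_exp_ofReal_mul_I _

lemma fchar_add (θ φ : ℝ) : fchar (θ + φ) = fchar θ * fchar φ := by
  unfold fchar
  rw [← Complex.exp_add]
  push_cast
  ring_nf

lemma fchar_zero : fchar 0 = 1 := by simp [fchar]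

lemma fchar_neg (θ : ℝ) : fchar (-θ) = (starRingEnd ℂ) (fchar θ) := by
  unfold fchar
  rw [← Complex.exp_conj, map_mul, Complex.conj_ofReal, Complex.conj_I]
  push_cast
  ring_nf

lemma continuous_fchar : Continuous fchar := by
  unfold fchar
  fun_prop

/-- The real part of the Fourier series with coefficients `b`, at the point `x`. -/
def fourierRe {d : ℕ} (b : (Fin d → ℤ) → ℂ) (x : Fin d → ℝ) : ℝ :=
  (∑' n, b n * fchar (∑ i, (n i : ℝ) * x i)).re

/-- Bounded Fourier multipliers on `ℤ^d` which preserve nonnegativity of the real part of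
absolutely convergent Fourier series. -/
structure IsPosMultiplier {d : ℕ} (a : (Fin d → ℤ) → ℂ) : Prop where
  bounded : ∃ C : ℝ, ∀ n, ‖a n‖ ≤ C
  nonneg : ∀ b : (Fin d → ℤ) → ℂ, Summable b → (∀ x, 0 ≤ fourierRe b x) →
    ∀ x, 0 ≤ fourierRe (fun n => a n * b n) x

section Multiplier

variable {d : ℕ} {a b : (Fin d → ℤ) → ℂ}

lemma summable_mul_fchar (hb : Summable b) (x : Fin d → ℝ) :
    Summable fun n => b n * fchar (∑ i, (n i : ℝ) * x i) := by
  rw [← summable_norm_iff] at hb ⊢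
  simpa [norm_fchar] using hb

lemma summable_bounded_mul {C : ℝ} (ha : ∀ n, ‖a n‖ ≤ C) (hb : Summable b) :
    Summable fun n => a n * b n := by
  rw [← summable_norm_iff] at hb
  refine Summable.of_norm_bounded (hb.mul_left C) fun n => ?_
  rw [norm_mul]
  exact mul_le_mul_of_nonneg_right (ha n) (norm_nonneg _)

lemma IsPosMultiplier.summable_mul (ha : IsPosMultiplier a) (hb : Summable b) :
    Summable fun n => a n * b n :=
  let ⟨_, hC⟩ := ha.bounded
  summable_bounded_mul hC hb

lemma fourierRe_add (ha : Summable a) (hb : Summable b) (x : Fin d → ℝ) :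
    fourierRe (fun n => a n + b n) x = fourierRe a x + fourierRe b x := by
  simp only [fourierRe, add_mul]
  rw [(summable_mul_fchar ha x).tsum_add (summable_mul_fchar hb x), Complex.add_re]

lemma fourierRe_const_mul (r : ℝ) (b : (Fin d → ℤ) → ℂ) (x : Fin d → ℝ) :
    fourierRe (fun n => (r : ℂ) * b n) x = r * fourierRe b x := by
  simp only [fourierRe, mul_assoc]
  rw [tsum_mul_left, Complex.re_ofReal_mul]

lemma fourierRe_ite_zero (c : ℂ) (x : Fin d → ℝ) :
    fourierRe (fun n : Fin d → ℤ => if n = 0 then c else 0) x = c.re := by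
  unfold fourierRe
  rw [tsum_eq_single 0 (by intro n hn; simp [hn])]
  simp [fchar_zero]

lemma tendsto_fourierRe {u : ℕ → (Fin d → ℤ) → ℂ} {bound : (Fin d → ℤ) → ℝ}
    (hbound : Summable bound) (hu : ∀ k n, ‖u k n‖ ≤ bound n)
    (hlim : ∀ n, Tendsto (fun k => u k n) atTop (𝓝 (b n))) (x : Fin d → ℝ) :
    Tendsto (fun k => fourierRe (u k) x) atTop (𝓝 (fourierRe b x)) := by
  unfold fourierRe
  refine (Complex.continuous_re.tendsto _).comp ?_
  refine tendsto_tsum_of_dominated_convergence hbound (fun n => (hlim n).mul_const _) ?_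
  refine Eventually.of_forall fun k n => ?_
  simpa [norm_fchar] using hu k n

lemma isPosMultiplier_one : IsPosMultiplier (fun _ : Fin d → ℤ => (1 : ℂ)) :=
  ⟨⟨1, by simp⟩, fun b _ h x => by simpa using h x⟩

lemma IsPosMultiplier.mul (ha : IsPosMultiplier a) (hb : IsPosMultiplier b) :
    IsPosMultiplier (fun n => a n * b n) := by
  obtain ⟨C, hC⟩ := ha.bounded
  obtain ⟨D, hD⟩ := hb.bounded
  refine ⟨⟨C * D, fun n => ?_⟩, fun f hf h x => ?_⟩
  · rw [norm_mul]
    exact mul_le_mul (hC n) (hD n) (norm_nonneg _) ((norm_nonneg _).trans (hC n))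
  · simpa only [mul_assoc] using ha.nonneg _ (hb.summable_mul hf) (hb.nonneg f hf h) x

lemma IsPosMultiplier.add (ha : IsPosMultiplier a) (hb : IsPosMultiplier b) :
    IsPosMultiplier (fun n => a n + b n) := by
  obtain ⟨C, hC⟩ := ha.bounded
  obtain ⟨D, hD⟩ := hb.bounded
  refine ⟨⟨C + D, fun n => (norm_add_le _ _).trans (add_le_add (hC n) (hD n))⟩,
    fun f hf h x => ?_⟩
  simp only [add_mul]
  rw [fourierRe_add (ha.summable_mul hf) (hb.summable_mul hf)]
  exact add_nonneg (ha.nonneg f hf h x) (hb.nonneg f hf h x)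

lemma IsPosMultiplier.const_mul (ha : IsPosMultiplier a) {r : ℝ} (hr : 0 ≤ r) :
    IsPosMultiplier (fun n => (r : ℂ) * a n) := by
  obtain ⟨C, hC⟩ := ha.bounded
  refine ⟨⟨r * C, fun n => ?_⟩, fun f hf h x => ?_⟩
  · rw [norm_mul, Complex.norm_of_nonneg hr]
    exact mul_le_mul_of_nonneg_left (hC n) hr
  · simp only [mul_assoc]
    rw [fourierRe_const_mul]
    exact mul_nonneg hr (ha.nonneg f hf h x)

lemma IsPosMultiplier.pow (ha : IsPosMultiplier a) (k : ℕ) :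
    IsPosMultiplier (fun n => a n ^ k) := by
  induction k with
  | zero => simpa using isPosMultiplier_one
  | succ k ih => simpa only [pow_succ] using ih.mul ha

lemma IsPosMultiplier.sum {ι : Type*} (s : Finset ι) {u : ι → (Fin d → ℤ) → ℂ}
    (hu : ∀ j, IsPosMultiplier (u j)) : IsPosMultiplier (fun n => ∑ j ∈ s, u j n) := by
  classical
  induction s using Finset.induction_on with
  | empty => simpa using isPosMultiplier_one.const_mul (d := d) le_rfl
  | insert j s hj ih => simpa only [Finset.sum_insert hj] using (hu j).add ih

lemma IsPosMultiplier.prod {ι : Type*} (s : Finset ι) {u : ι → (Fin d → ℤ) → ℂ}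
    (hu : ∀ j, IsPosMultiplier (u j)) : IsPosMultiplier (fun n => ∏ j ∈ s, u j n) := by
  classical
  induction s using Finset.induction_on with
  | empty => simpa using isPosMultiplier_one
  | insert j s hj ih => simpa only [Finset.prod_insert hj] using (hu j).mul ih

lemma IsPosMultiplier.of_tendsto {u : ℕ → (Fin d → ℤ) → ℂ} {C : ℝ}
    (hu : ∀ k, IsPosMultiplier (u k)) (hC : ∀ k n, ‖u k n‖ ≤ C)
    (hlim : ∀ n, Tendsto (fun k => u k n) atTop (𝓝 (a n))) : IsPosMultiplier a := by
  refine ⟨⟨C, fun n => le_of_tendsto (hlim n).norm (Eventually.of_forall fun k => hC k n)⟩,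
    fun f hf h x => ?_⟩
  refine ge_of_tendsto (tendsto_fourierRe (u := fun k n => u k n * f n)
    ((summable_norm_iff.2 hf).mul_left C) (fun k n => ?_)
    (fun n => (hlim n).mul_const _) x) (Eventually.of_forall fun k => (hu k).nonneg f hf h x)
  rw [norm_mul]
  exact mul_le_mul_of_nonneg_right (hC k n) (norm_nonneg _)

lemma isPosMultiplier_translation (y : Fin d → ℝ) :
    IsPosMultiplier (fun n : Fin d → ℤ => fchar (∑ i, (n i : ℝ) * y i)) := by
  refine ⟨⟨1, fun n => (norm_fchar _).le⟩, fun f _ h x => ?_⟩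
  convert h (y + x) using 1
  unfold fourierRe
  congr 2
  ext n
  simp only [Pi.add_apply, mul_add, Finset.sum_add_distrib, fchar_add]
  ring

lemma IsPosMultiplier.integral {Ω : Type*} [MeasurableSpace Ω] {μ : Measure Ω}
    {A : Ω → (Fin d → ℤ) → ℂ} {W : Ω → ℝ} (hW : Integrable W μ)
    (hA : ∀ᵐ ω ∂μ, IsPosMultiplier (A ω)) (hAW : ∀ᵐ ω ∂μ, ∀ n, ‖A ω n‖ ≤ W ω)
    (hm : ∀ n, AEStronglyMeasurable (fun ω => A ω n) μ) :
    IsPosMultiplier (fun n => ∫ ω, A ω n ∂μ) := by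
  have hint : ∀ n, Integrable (fun ω => A ω n) μ := fun n =>
    hW.mono' (hm n) (hAW.mono fun ω h => h n)
  have hle : ∀ n, ∫ ω, ‖A ω n‖ ∂μ ≤ ∫ ω, W ω ∂μ := fun n =>
    integral_mono_ae (hint n).norm hW (hAW.mono fun ω h => h n)
  refine ⟨⟨∫ ω, W ω ∂μ, fun n => (norm_integral_le_integral_norm _).trans (hle n)⟩,
    fun f hf h x => ?_⟩
  have key := hasSum_integral_of_summable_integral_norm
    (F := fun n ω => A ω n * f n * fchar (∑ i, (n i : ℝ) * x i)) (μ := μ)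
    (fun n => ((hint n).mul_const _).mul_const _) (by
      refine Summable.of_nonneg_of_le (fun n => by positivity) (fun n => ?_)
        ((summable_norm_iff.2 hf).mul_left (∫ ω, W ω ∂μ))
      simp only [norm_mul, norm_fchar, mul_one, integral_mul_const]
      exact mul_le_mul_of_nonneg_right (hle n) (norm_nonneg _))
  have hsum : Integrable (fun ω => ∑' n, A ω n * f n * fchar (∑ i, (n i : ℝ) * x i)) μ := by
    refine (hW.mul_const (∑' n, ‖f n‖)).mono' ?_ ?_
    · refine aestronglyMeasurable_of_tendsto_ae (atTop : Filter (Finset (Fin d → ℤ)))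
        (f := fun s ω => ∑ n ∈ s, A ω n * f n * fchar (∑ i, (n i : ℝ) * x i)) (fun s => ?_) ?_
      · exact Finset.aestronglyMeasurable_fun_sum _ fun n _ =>
          ((hm n).mul_const _).mul_const _
      · filter_upwards [hAW] with ω hω
        exact (summable_mul_fchar (summable_bounded_mul hω hf) x).hasSum
    · filter_upwards [hAW] with ω hω
      refine (norm_tsum_le_tsum_norm ?_).trans ?_
      · exact summable_norm_iff.2 (summable_mul_fchar (summable_bounded_mul hω hf) x)
      · rw [← tsum_mul_left]
        refine Summable.tsum_le_tsum (fun n => ?_)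
          (summable_norm_iff.2 (summable_mul_fchar (summable_bounded_mul hω hf) x))
          ((summable_norm_iff.2 hf).mul_left _)
        simp only [norm_mul, norm_fchar, mul_one]
        exact mul_le_mul_of_nonneg_right (hω n) (norm_nonneg _)
  unfold fourierRe
  simp only [integral_mul_const] at key
  rw [key.tsum_eq]
  refine le_of_le_of_eq ?_ (integral_re hsum)
  exact integral_nonneg_of_ae (hA.mono fun ω hω => hω.nonneg f hf h x)

lemma norm_sum_pow_div_factorial_le {z : ℂ} {C : ℝ} (hz : ‖z‖ ≤ C) (s : Finset ℕ) :
    ‖∑ k ∈ s, (((k.factorial : ℝ)⁻¹ : ℝ) : ℂ) * z ^ k‖ ≤ Real.exp C := by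
  have hC : 0 ≤ C := (norm_nonneg _).trans hz
  calc _ ≤ ∑ k ∈ s, C ^ k / (k.factorial : ℝ) := by
        refine norm_sum_le_of_le _ fun k _ => ?_
        rw [norm_mul, norm_pow, Complex.norm_of_nonneg (by positivity), div_eq_inv_mul]
        gcongr
    _ ≤ Real.exp C := by
        rw [Real.exp_eq_exp_ℝ, NormedSpace.exp_eq_tsum_div]
        exact (Real.summable_pow_div_factorial C).sum_le_tsum _ (fun _ _ => by positivity)

lemma tendsto_sum_pow_div_factorial (z : ℂ) :
    Tendsto (fun K => ∑ k ∈ Finset.range K, (((k.factorial : ℝ)⁻¹ : ℝ) : ℂ) * z ^ k) atTop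
      (𝓝 (Complex.exp z)) := by
  have := (NormedSpace.expSeries_div_hasSum_exp z).tendsto_sum_nat
  rw [← Complex.exp_eq_exp_ℂ] at this
  simpa [div_eq_inv_mul] using this

lemma IsPosMultiplier.exp (ha : IsPosMultiplier a) :
    IsPosMultiplier (fun n => Complex.exp (a n)) := by
  obtain ⟨C, hC⟩ := ha.bounded
  exact .of_tendsto (fun K => .sum (Finset.range K) fun k =>
      (ha.pow k).const_mul (r := (k.factorial : ℝ)⁻¹) (by positivity))
    (fun K n => norm_sum_pow_div_factorial_le (hC n) _)
    (fun n => tendsto_sum_pow_div_factorial _)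

lemma IsPosMultiplier.exp_sub_one_sub (ha : IsPosMultiplier a) :
    IsPosMultiplier (fun n => Complex.exp (a n) - 1 - a n) := by
  obtain ⟨C, hC⟩ := ha.bounded
  refine .of_tendsto (fun K => .sum (Finset.Ico 2 (K + 2)) fun k =>
      (ha.pow k).const_mul (r := (k.factorial : ℝ)⁻¹) (by positivity))
    (fun K n => norm_sum_pow_div_factorial_le (hC n) _) (fun n => ?_)
  have := ((tendsto_add_atTop_iff_nat 2).2 (tendsto_sum_pow_div_factorial (a n))).sub_const
    (1 + a n)
  rw [← sub_sub] at this
  refine this.congr fun K => ?_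
  rw [Finset.sum_Ico_eq_sub _ (by omega : 2 ≤ K + 2)]
  simp [Finset.sum_range_succ]

/-- A multiplier equal to one at the origin preserves lower bounds. -/
lemma IsPosMultiplier.le_fourierRe (ha : IsPosMultiplier a) (ha0 : a 0 = 1)
    (hb : Summable b) {c : ℝ} (h : ∀ x, c ≤ fourierRe b x) (x : Fin d → ℝ) :
    c ≤ fourierRe (fun n => a n * b n) x := by
  have hs : ∀ c : ℂ, Summable (fun n : Fin d → ℤ => if n = 0 then c else 0) := fun c =>
    summable_of_ne_finset_zero (s := {0}) fun n hn => if_neg (by simpa using hn)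
  have h1 := ha.nonneg (fun n => b n + if n = 0 then (-c : ℂ) else 0) (hb.add (hs _))
    (fun y => by
      rw [fourierRe_add hb (hs _), fourierRe_ite_zero]
      simpa using h y) x
  have h2 : (fun n => a n * (b n + if n = 0 then (-c : ℂ) else 0)) =
      fun n => a n * b n + if n = 0 then (-c : ℂ) else 0 := by
    ext n
    rcases eq_or_ne n 0 with rfl | hn
    · simp [ha0, mul_add]
    · simp [hn]
  rw [h2, fourierRe_add (ha.summable_mul hb) (hs _), fourierRe_ite_zero] at h1
  simpa using h1

end Multiplier

section Fejer

variable {d : ℕ}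

/-- The number of ways to write `n` as a difference of two elements of `F`. -/
def diffCount (F : Finset (Fin d → ℤ)) (n : Fin d → ℤ) : ℝ :=
  ((F.filter fun l => l + n ∈ F).card : ℝ)

lemma diffCount_eq_sum (F : Finset (Fin d → ℤ)) (n : Fin d → ℤ) :
    ((diffCount F n : ℝ) : ℂ) = ∑ l ∈ F, ∑ k ∈ F, if n = k - l then 1 else 0 := by
  have : ∀ l k : Fin d → ℤ, n = k - l ↔ k = l + n := fun l k => by
    rw [eq_sub_iff_add_eq, add_comm, eq_comm]
  simp only [diffCount, this, Finset.sum_ite_eq', Finset.sum_boole, Complex.ofReal_natCast]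

lemma hasSum_diffCount_mul (F : Finset (Fin d → ℤ)) (g : (Fin d → ℤ) → ℂ) :
    HasSum (fun n => ((diffCount F n : ℝ) : ℂ) * g n) (∑ l ∈ F, ∑ k ∈ F, g (k - l)) := by
  have : (fun n => ((diffCount F n : ℝ) : ℂ) * g n) =
      fun n => ∑ l ∈ F, ∑ k ∈ F, if n = k - l then g (k - l) else 0 := by
    ext n
    rw [diffCount_eq_sum, Finset.sum_mul]
    refine Finset.sum_congr rfl fun l _ => ?_
    rw [Finset.sum_mul]
    refine Finset.sum_congr rfl fun k _ => ?_
    split_ifs with h <;> simp [h]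
  rw [this]
  exact hasSum_sum fun l _ => hasSum_sum fun k _ => hasSum_ite_eq _ _

lemma fourierRe_diffCount_nonneg (F : Finset (Fin d → ℤ)) (x : Fin d → ℝ) :
    0 ≤ fourierRe (fun n => ((diffCount F n : ℝ) : ℂ)) x := by
  unfold fourierRe
  rw [(hasSum_diffCount_mul F _).tsum_eq]
  have : ∑ l ∈ F, ∑ k ∈ F, fchar (∑ i, (((k - l) i : ℤ) : ℝ) * x i) =
      (∑ l ∈ F, (starRingEnd ℂ) (fchar (∑ i, (l i : ℝ) * x i))) *
        ∑ k ∈ F, fchar (∑ i, (k i : ℝ) * x i) := by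
    rw [Finset.sum_mul_sum]
    refine Finset.sum_congr rfl fun l _ => Finset.sum_congr rfl fun k _ => ?_
    rw [← fchar_neg, ← fchar_add]
    simp only [Pi.sub_apply, Int.cast_sub, sub_mul, Finset.sum_sub_distrib]
    rw [sub_eq_neg_add]
  rw [this, ← map_sum, ← Complex.normSq_eq_conj_mul_self, Complex.ofReal_re]
  exact Complex.normSq_nonneg _

/-- The coefficients of the `d`-dimensional Fejér kernel. -/
def fejerCoeff (N : ℕ) (n : Fin d → ℤ) : ℝ :=
  ((N : ℝ) ^ d)⁻¹ * diffCount (Fintype.piFinset fun _ => Finset.Ico (0 : ℤ) N) n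

lemma fejerCoeff_nonneg (N : ℕ) (n : Fin d → ℤ) : 0 ≤ fejerCoeff N n := by
  unfold fejerCoeff diffCount
  positivity

lemma fejerCoeff_le_one (N : ℕ) (n : Fin d → ℤ) : fejerCoeff N n ≤ 1 := by
  unfold fejerCoeff diffCount
  have h := Finset.card_filter_le (Fintype.piFinset fun _ : Fin d => Finset.Ico (0 : ℤ) N)
    (fun l => l + n ∈ Fintype.piFinset fun _ : Fin d => Finset.Ico (0 : ℤ) N)
  rw [Fintype.card_piFinset_const] at h
  simp only [Int.card_Ico, sub_zero, Int.toNat_natCast] at h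
  refine (mul_le_mul_of_nonneg_left (?_ : _ ≤ (N : ℝ) ^ d) (by positivity)).trans
    inv_mul_le_one
  exact_mod_cast h

lemma tendsto_fejerCoeff (n : Fin d → ℤ) :
    Tendsto (fun N => fejerCoeff N n) atTop (𝓝 1) := by
  have h1 : Tendsto (fun N : ℕ => ∏ i, (1 - |(n i : ℝ)| / N)) atTop (𝓝 (∏ _i : Fin d, 1)) := by
    refine tendsto_finsetProd _ fun i _ => ?_
    simpa using (tendsto_const_div_atTop_nhds_zero_nat (|(n i : ℝ)|)).const_sub 1
  rw [Finset.prod_const_one] at h1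
  refine h1.congr' ?_
  have h2 : ∀ᶠ N : ℕ in atTop, ∀ i, (n i).natAbs ≤ N :=
    eventually_all.2 fun i => eventually_ge_atTop _
  filter_upwards [h2, eventually_gt_atTop 0] with N hN hN0
  have h3 : ((Fintype.piFinset fun _ : Fin d => Finset.Ico (0 : ℤ) N).filter
      fun l => l + n ∈ Fintype.piFinset fun _ : Fin d => Finset.Ico (0 : ℤ) N) =
      Fintype.piFinset fun i => Finset.Ico (max 0 (-n i)) (min (N : ℤ) (N - n i)) := by
    ext l
    simp only [Finset.mem_filter, Fintype.mem_piFinset, Finset.mem_Ico, Pi.add_apply,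
      ← forall_and]
    refine forall_congr' fun i => ?_
    omega
  have h4 : ∀ i, ((min (N : ℤ) (N - n i) - max 0 (-n i)).toNat : ℝ) = N - |(n i : ℝ)| := by
    intro i
    have h := hN i
    have h5 : ((min (N : ℤ) (N - n i) - max 0 (-n i)).toNat : ℤ) = N - |n i| := by
      rcases abs_cases (n i) with h' | h' <;> omega
    exact_mod_cast h5
  unfold fejerCoeff diffCount
  rw [h3, Fintype.card_piFinset]
  simp only [Int.card_Ico, Nat.cast_prod, h4]
  have h6 : (N : ℝ) ^ d = ∏ _i : Fin d, (N : ℝ) := by simp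
  rw [h6, ← Finset.prod_inv_distrib, ← Finset.prod_mul_distrib]
  refine Finset.prod_congr rfl fun i _ => ?_
  field_simp

lemma IsPosMultiplier.fourierRe_nonneg {a : (Fin d → ℤ) → ℂ} (ha : IsPosMultiplier a)
    (hs : Summable a) (x : Fin d → ℝ) : 0 ≤ fourierRe a x := by
  refine ge_of_tendsto (tendsto_fourierRe (b := a)
    (u := fun N n => a n * ((fejerCoeff N n : ℝ) : ℂ))
    (summable_norm_iff.2 hs) (fun N n => ?_) (fun n => ?_) x) (Eventually.of_forall fun N => ?_)
  · rw [norm_mul, Complex.norm_of_nonneg (fejerCoeff_nonneg N n)]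
    exact mul_le_of_le_one_right (norm_nonneg _) (fejerCoeff_le_one N n)
  · have := ((Complex.continuous_ofReal.tendsto _).comp (tendsto_fejerCoeff n)).const_mul (a n)
    simpa using this
  · refine ha.nonneg _ ?_ (fun y => ?_) x
    · have := (hasSum_diffCount_mul (Fintype.piFinset fun _ : Fin d => Finset.Ico (0 : ℤ) N)
        (fun _ => 1)).summable
      simp only [mul_one] at this
      simp only [fejerCoeff, Complex.ofReal_mul]
      exact this.mul_left _
    · simp only [fejerCoeff, Complex.ofReal_mul]
      rw [fourierRe_const_mul]
      exact mul_nonneg (by positivity) (fourierRe_diffCount_nonneg _ y)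

end Fejer

section Gaussian

variable {d : ℕ}

/-- The eigenvalue of the Laplacian `-Δ` on the torus at frequency `n`. -/
def torusEigenvalue (n : Fin d → ℤ) : ℝ := ∑ i, (2 * Real.pi * n i) ^ 2

lemma torusEigenvalue_nonneg (n : Fin d → ℤ) : 0 ≤ torusEigenvalue n :=
  Finset.sum_nonneg fun _ _ => sq_nonneg _

lemma torusEigenvalue_zero : torusEigenvalue (0 : Fin d → ℤ) = 0 := by
  simp [torusEigenvalue]

lemma norm_sq_le_torusEigenvalue (n : Fin d → ℤ) :
    ‖(fun i => (n i : ℝ))‖ ^ 2 ≤ torusEigenvalue n := by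
  rw [← Real.sqrt_le_sqrt_iff (torusEigenvalue_nonneg n), Real.sqrt_sq (norm_nonneg _),
    pi_norm_le_iff_of_nonneg (Real.sqrt_nonneg _)]
  intro i
  rw [Real.norm_eq_abs]
  refine Real.abs_le_sqrt (le_trans ?_
    (Finset.single_le_sum (f := fun i => (2 * Real.pi * (n i : ℝ)) ^ 2)
      (fun _ _ => sq_nonneg _) (Finset.mem_univ i)))
  rw [mul_pow]
  refine le_mul_of_one_le_left (sq_nonneg _) ?_
  nlinarith [Real.pi_gt_three]

lemma one_le_torusEigenvalue {n : Fin d → ℤ} (hn : n ≠ 0) : 1 ≤ torusEigenvalue n := by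
  refine le_trans ?_ (norm_sq_le_torusEigenvalue n)
  obtain ⟨i, hi⟩ := Function.ne_iff.1 hn
  have h1 : (1 : ℝ) ≤ |(n i : ℝ)| := by exact_mod_cast Int.one_le_abs hi
  have h2 := norm_le_pi_norm (fun i => (n i : ℝ)) i
  rw [Real.norm_eq_abs] at h2
  nlinarith

lemma torusEigenvalue_rpow_half (n : Fin d → ℤ) (α : ℝ) :
    (2 * Real.pi * Real.sqrt (∑ i, (n i : ℝ) ^ 2)) ^ α = torusEigenvalue n ^ (α / 2) := by
  have h : 2 * Real.pi * Real.sqrt (∑ i, (n i : ℝ) ^ 2) = Real.sqrt (torusEigenvalue n) := by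
    simp only [torusEigenvalue, mul_pow (2 * Real.pi)]
    rw [← Finset.mul_sum, Real.sqrt_mul (sq_nonneg _), Real.sqrt_sq (by positivity)]
  rw [h, Real.sqrt_eq_rpow, ← Real.rpow_mul (torusEigenvalue_nonneg n)]
  ring_nf

lemma isPosMultiplier_gaussian {s : ℝ} (hs : 0 ≤ s) :
    IsPosMultiplier (fun n : Fin d → ℤ => ((Real.exp (-(s * torusEigenvalue n)) : ℝ) : ℂ)) := by
  have h : ∀ i : Fin d, IsPosMultiplier
      (fun n : Fin d → ℤ => ((Real.exp (-(s * (2 * Real.pi * n i) ^ 2)) : ℝ) : ℂ)) := by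
    intro i
    have h1 := IsPosMultiplier.integral (d := d)
      (μ := ProbabilityTheory.gaussianReal 0 (2 * s).toNNReal)
      (A := fun y n => fchar ((n i : ℝ) * y)) (W := fun _ => 1) (integrable_const _)
      (Eventually.of_forall fun y => by
        have := isPosMultiplier_translation (Pi.single i y : Fin d → ℝ)
        simpa [Pi.single_apply] using this)
      (Eventually.of_forall fun y n => (norm_fchar _).le)
      (fun n => (continuous_fchar.comp (continuous_const.mul continuous_id)).aestronglyMeasurable)
    convert h1 using 2 with n
    have h2 := ProbabilityTheory.charFun_gaussianReal (μ := 0) (v := (2 * s).toNNReal)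
      (2 * Real.pi * n i)
    rw [charFun_apply_real] at h2
    calc _ = _ := ?_
      _ = _ := h2.symm
      _ = _ := ?_
    · rw [Complex.ofReal_exp]
      congr 1
      rw [Real.coe_toNNReal _ (by positivity)]
      push_cast
      ring
    · refine integral_congr_ae (Eventually.of_forall fun y => ?_)
      simp only [fchar]
      push_cast
      ring_nf
  have := IsPosMultiplier.prod Finset.univ h
  simpa [torusEigenvalue, Finset.mul_sum, ← Finset.sum_neg_distrib, Real.exp_sum,
    Complex.exp_sum] using this

lemma summable_norm_rpow_int {r : ℝ} (hr : r < -(d : ℝ)) :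
    Summable fun n : Fin d → ℤ => ‖(fun i => (n i : ℝ))‖ ^ r := by
  obtain ⟨L, hL⟩ : ∃ L, L = Submodule.span ℤ (Set.range (Pi.basisFun ℝ (Fin d))) := ⟨_, rfl⟩
  have hd : DiscreteTopology L := by
    rw [hL]
    infer_instance
  have hz : IsZLattice ℝ L := by
    subst hL
    infer_instance
  have hr' : Module.finrank ℤ L = d := by
    rw [ZLattice.rank ℝ L, Module.finrank_fin_fun]
  have h := ZLattice.summable_norm_rpow L r (by rwa [hr'])
  have hmem : ∀ n : Fin d → ℤ, (fun i => (n i : ℝ)) ∈ L := by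
    intro n
    rw [hL, Module.Basis.mem_span_iff_repr_mem]
    intro i
    exact ⟨n i, by simp⟩
  refine h.comp_injective (i := fun n : Fin d → ℤ => (⟨fun i => (n i : ℝ), hmem n⟩ : L)) ?_
  intro m n hmn
  ext i
  have : (m i : ℝ) = n i := congrFun (Subtype.ext_iff.1 hmn) i
  exact_mod_cast this

lemma summable_exp_neg_torusEigenvalue_rpow {t β : ℝ} (ht : 0 < t) (hβ : 0 < β) :
    Summable fun n : Fin d → ℤ => Real.exp (-(t * torusEigenvalue n ^ β)) := by
  obtain ⟨k, hk⟩ := exists_nat_gt ((d : ℝ) / (2 * β))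
  have hk' : -(2 * β * k) < -(d : ℝ) := by
    rw [div_lt_iff₀ (by positivity)] at hk
    linarith
  refine Summable.of_norm_bounded_eventually
    ((summable_norm_rpow_int hk').mul_left ((k.factorial : ℝ) / t ^ k)) ?_
  have : ∀ᶠ n : Fin d → ℤ in cofinite, n ≠ 0 := by
    simp
  filter_upwards [this] with n hn
  rw [Real.norm_of_nonneg (Real.exp_pos _).le, Real.exp_neg]
  have hpos : 0 < ‖(fun i => (n i : ℝ))‖ := by
    rw [norm_pos_iff]
    intro h
    refine hn (funext fun i => ?_)
    have := congrFun h i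
    simpa using this
  have h1 := Real.pow_div_factorial_le_exp (x := t * torusEigenvalue n ^ β)
    (mul_nonneg ht.le (Real.rpow_nonneg (torusEigenvalue_nonneg n) _)) k
  have h2 : (‖(fun i => (n i : ℝ))‖ ^ 2) ^ β ≤ torusEigenvalue n ^ β :=
    Real.rpow_le_rpow (by positivity) (norm_sq_le_torusEigenvalue n) hβ.le
  have h3 : ‖(fun i => (n i : ℝ))‖ ^ (-(2 * β * k)) =
      (((‖(fun i => (n i : ℝ))‖ ^ 2) ^ β) ^ k)⁻¹ := by
    rw [Real.rpow_neg hpos.le, ← Real.rpow_natCast, ← Real.rpow_natCast,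
      ← Real.rpow_mul hpos.le, ← Real.rpow_mul hpos.le]
    norm_num
  have hv : 0 < (‖(fun i => (n i : ℝ))‖ ^ 2) ^ β := by positivity
  rw [h3]
  calc _ ≤ ((t * (‖(fun i => (n i : ℝ))‖ ^ 2) ^ β) ^ k / k.factorial)⁻¹ := by
        refine inv_anti₀ (by positivity) (le_trans ?_ h1)
        gcongr
    _ = _ := by
        rw [mul_pow]
        field_simp

end Gaussian

section Levy

open Set

/-- The integrand in the Lévy–Khintchine formula for the `β`-stable subordinator. -/
def stableIntegrand (β l s : ℝ) : ℝ := (1 - Real.exp (-(s * l))) * s ^ (-1 - β)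

lemma stableIntegrand_nonneg (β : ℝ) {l s : ℝ} (hl : 0 ≤ l) (hs : 0 ≤ s) :
    0 ≤ stableIntegrand β l s := by
  refine mul_nonneg ?_ (Real.rpow_nonneg hs _)
  have : Real.exp (-(s * l)) ≤ 1 := Real.exp_le_one_iff.2 (by nlinarith [mul_nonneg hs hl])
  linarith

lemma measurable_stableIntegrand (β l : ℝ) : Measurable (stableIntegrand β l) := by
  unfold stableIntegrand
  fun_prop

lemma integrableOn_stableIntegrand {β l : ℝ} (hβ0 : 0 < β) (hβ1 : β < 1) (hl : 0 ≤ l) :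
    IntegrableOn (stableIntegrand β l) (Ioi 0) := by
  rw [← Ioc_union_Ioi_eq_Ioi zero_le_one]
  refine IntegrableOn.union ?_ ?_
  · have h1 : IntegrableOn (fun s : ℝ => l * s ^ (-β)) (Ioc 0 1) := by
      have := (intervalIntegral.intervalIntegrable_rpow' (a := 0) (b := 1)
        (by linarith : -1 < -β)).1
      exact this.const_mul l
    refine Integrable.mono' h1 (measurable_stableIntegrand β l).aestronglyMeasurable ?_
    filter_upwards [ae_restrict_mem measurableSet_Ioc] with s hs
    rw [Real.norm_of_nonneg (stableIntegrand_nonneg β hl hs.1.le)]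
    have h2 : 1 - Real.exp (-(s * l)) ≤ s * l := by
      linarith [Real.add_one_le_exp (-(s * l))]
    calc _ ≤ s * l * s ^ (-1 - β) :=
          mul_le_mul_of_nonneg_right h2 (Real.rpow_nonneg hs.1.le _)
      _ = l * s ^ (-β) := by
          have : -β = 1 + (-1 - β) := by ring
          rw [this, Real.rpow_add hs.1, Real.rpow_one]
          ring
  · refine Integrable.mono' (integrableOn_Ioi_rpow_of_lt (by linarith : -1 - β < -1) one_pos)
      (measurable_stableIntegrand β l).aestronglyMeasurable ?_
    filter_upwards [ae_restrict_mem measurableSet_Ioi] with s hs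
    have hs0 : (0 : ℝ) ≤ s := zero_le_one.trans (le_of_lt hs)
    rw [Real.norm_of_nonneg (stableIntegrand_nonneg β hl hs0)]
    refine mul_le_of_le_one_left (Real.rpow_nonneg hs0 _) ?_
    linarith [Real.exp_pos (-(s * l))]

lemma integral_stableIntegrand {β l : ℝ} (hβ0 : 0 < β) (hl : 0 ≤ l) :
    ∫ s in Ioi 0, stableIntegrand β l s = l ^ β * ∫ s in Ioi 0, stableIntegrand β 1 s := by
  rcases hl.eq_or_lt with rfl | hl
  · simp [stableIntegrand, Real.zero_rpow hβ0.ne']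
  have h := integral_comp_mul_left_Ioi (stableIntegrand β 1) 0 hl
  have h2 : ∫ s in Ioi (0 : ℝ), stableIntegrand β 1 (l * s) =
      ∫ s in Ioi (0 : ℝ), l ^ (-1 - β) * stableIntegrand β l s := by
    refine setIntegral_congr_fun measurableSet_Ioi fun s hs => ?_
    simp only [stableIntegrand, mul_one]
    rw [Real.mul_rpow hl.le (le_of_lt hs)]
    ring_nf
  rw [h2, integral_const_mul, mul_zero, smul_eq_mul] at h
  have h3 : l ^ β * l * l ^ (-1 - β) = 1 := by
    nth_rw 2 [← Real.rpow_one l]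
    rw [← Real.rpow_add hl, ← Real.rpow_add hl]
    ring_nf
    simp
  calc _ = l ^ β * l * (l ^ (-1 - β) * ∫ s in Ioi 0, stableIntegrand β l s) := by
        rw [← mul_assoc, h3, one_mul]
    _ = _ := by
        rw [h]
        field_simp

lemma integral_stableIntegrand_one_pos {β : ℝ} (hβ0 : 0 < β) (hβ1 : β < 1) :
    0 < ∫ s in Ioi 0, stableIntegrand β 1 s := by
  rw [setIntegral_pos_iff_support_of_nonneg_ae]
  · have : Function.support (stableIntegrand β 1) ∩ Ioi 0 = Ioi 0 := by
      refine inter_eq_right.2 fun s hs => ?_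
      refine mul_ne_zero ?_ (Real.rpow_pos_of_pos hs _).ne'
      have : Real.exp (-(s * 1)) < 1 := by
        rw [Real.exp_lt_one_iff]
        simpa using hs
      linarith
    rw [this]
    simp
  · filter_upwards [ae_restrict_mem measurableSet_Ioi] with s hs
    exact stableIntegrand_nonneg β zero_le_one (le_of_lt hs)
  · exact integrableOn_stableIntegrand hβ0 hβ1 zero_le_one

/-- The Laplace transform of the stable Lévy measure restricted to `A`. -/
def stableLaplace (β : ℝ) (A : Set ℝ) (l : ℝ) : ℝ :=
  ∫ s in A, Real.exp (-(s * l)) * s ^ (-1 - β)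

lemma integrableOn_exp_mul_rpow {β δ l : ℝ} {A : Set ℝ} (hβ : 0 < β) (hδ : 0 < δ)
    (hA : MeasurableSet A) (hAδ : A ⊆ Ioi δ) (hl : 0 ≤ l) :
    IntegrableOn (fun s => Real.exp (-(s * l)) * s ^ (-1 - β)) A := by
  have h := (integrableOn_Ioi_rpow_of_lt (by linarith : -1 - β < -1) hδ).mono_set hAδ
  refine Integrable.mono' h (by fun_prop) ?_
  filter_upwards [ae_restrict_mem hA] with s hs
  have hs0 : 0 ≤ s := (hδ.trans (hAδ hs)).le
  rw [Real.norm_of_nonneg (by positivity)]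
  refine mul_le_of_le_one_left (Real.rpow_nonneg hs0 _) (Real.exp_le_one_iff.2 ?_)
  linarith [mul_nonneg hs0 hl]

lemma setIntegral_stableIntegrand {β δ l : ℝ} {A : Set ℝ} (hβ : 0 < β) (hδ : 0 < δ)
    (hA : MeasurableSet A) (hAδ : A ⊆ Ioi δ) (hl : 0 ≤ l) :
    ∫ s in A, stableIntegrand β l s = stableLaplace β A 0 - stableLaplace β A l := by
  unfold stableLaplace
  rw [← integral_sub (integrableOn_exp_mul_rpow hβ hδ hA hAδ le_rfl)
    (integrableOn_exp_mul_rpow hβ hδ hA hAδ hl)]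
  refine integral_congr_ae (Eventually.of_forall fun s => ?_)
  simp [stableIntegrand, sub_mul]

lemma stableLaplace_nonneg {β δ : ℝ} {A : Set ℝ} (hδ : 0 < δ)
    (hA : MeasurableSet A) (hAδ : A ⊆ Ioi δ) (l : ℝ) : 0 ≤ stableLaplace β A l :=
  setIntegral_nonneg hA fun _ hs =>
    mul_nonneg (Real.exp_pos _).le (Real.rpow_nonneg (hδ.trans (hAδ hs)).le _)

lemma stableLaplace_Ioi_le {β S l : ℝ} (hβ : 0 < β) (hS : 0 < S) (hl : 0 ≤ l) :
    stableLaplace β (Ioi S) l ≤ Real.exp (-(S * l)) * stableLaplace β (Ioi S) 0 := by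
  unfold stableLaplace
  rw [← integral_const_mul]
  refine setIntegral_mono_on (integrableOn_exp_mul_rpow hβ hS measurableSet_Ioi subset_rfl hl)
    ((integrableOn_exp_mul_rpow hβ hS measurableSet_Ioi subset_rfl le_rfl).const_mul _)
    measurableSet_Ioi fun s hs => ?_
  have hs0 : 0 < s := hS.trans hs
  simp only [mul_zero, neg_zero, Real.exp_zero, one_mul]
  refine mul_le_mul_of_nonneg_right (Real.exp_le_exp.2 ?_) (Real.rpow_nonneg hs0.le _)
  exact neg_le_neg (mul_le_mul_of_nonneg_right (le_of_lt hs) hl)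

lemma stableLaplace_Ioi_zero_pos {β S : ℝ} (hβ : 0 < β) (hS : 0 < S) :
    0 < stableLaplace β (Ioi S) 0 := by
  simp only [stableLaplace, mul_zero, neg_zero, Real.exp_zero, one_mul]
  rw [integral_Ioi_rpow_of_lt (by linarith) hS]
  have := Real.rpow_pos_of_pos hS (-1 - β + 1)
  rw [neg_div, ← div_neg]
  exact div_pos this (by linarith)

variable {d : ℕ}

lemma isPosMultiplier_stableLaplace {β δ : ℝ} {A : Set ℝ} (hβ : 0 < β) (hδ : 0 < δ)
    (hA : MeasurableSet A) (hAδ : A ⊆ Ioi δ) :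
    IsPosMultiplier (fun n : Fin d → ℤ => ((stableLaplace β A (torusEigenvalue n) : ℝ) : ℂ)) := by
  have h := IsPosMultiplier.integral (d := d) (μ := volume.restrict A)
    (A := fun s n => ((s ^ (-1 - β) : ℝ) : ℂ) *
      ((Real.exp (-(s * torusEigenvalue n)) : ℝ) : ℂ))
    (W := fun s => s ^ (-1 - β))
    ((integrableOn_Ioi_rpow_of_lt (by linarith : -1 - β < -1) hδ).mono_set hAδ)
    (by
      filter_upwards [ae_restrict_mem hA] with s hs
      have hs0 : 0 ≤ s := (hδ.trans (hAδ hs)).le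
      exact (isPosMultiplier_gaussian hs0).const_mul (Real.rpow_nonneg hs0 _))
    (by
      filter_upwards [ae_restrict_mem hA] with s hs n
      have hs0 : 0 ≤ s := (hδ.trans (hAδ hs)).le
      rw [norm_mul, Complex.norm_of_nonneg (Real.rpow_nonneg hs0 _),
        Complex.norm_of_nonneg (Real.exp_pos _).le]
      refine mul_le_of_le_one_right (Real.rpow_nonneg hs0 _) (Real.exp_le_one_iff.2 ?_)
      linarith [mul_nonneg hs0 (torusEigenvalue_nonneg n)])
    (fun n => by fun_prop)
  convert h using 2 with n
  rw [stableLaplace, ← integral_complex_ofReal]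
  refine integral_congr_ae (Eventually.of_forall fun s => ?_)
  simp only
  push_cast
  ring

/-- The compensated small jump part of the stable semigroup is a positive multiplier. -/
lemma isPosMultiplier_exp_neg_setIntegral {β r S : ℝ} (hβ0 : 0 < β) (hβ1 : β < 1)
    (hr : 0 ≤ r) :
    IsPosMultiplier (fun n : Fin d → ℤ =>
      ((Real.exp (-(r * ∫ s in Ioc 0 S, stableIntegrand β (torusEigenvalue n) s)) : ℝ) : ℂ)) := by
  refine .of_tendsto (C := 1) (u := fun k n => ((Real.exp (-(r *
    ∫ s in Ioc (1 / ((k : ℝ) + 1)) S, stableIntegrand β (torusEigenvalue n) s)) : ℝ) : ℂ))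
    (fun k => ?_) (fun k n => ?_) (fun n => ?_)
  · have hk : (0 : ℝ) < 1 / ((k : ℝ) + 1) := by positivity
    have hsub : Ioc (1 / ((k : ℝ) + 1)) S ⊆ Ioi (1 / ((k : ℝ) + 1)) := Ioc_subset_Ioi_self
    have h := ((isPosMultiplier_stableLaplace (d := d) hβ0 hk measurableSet_Ioc
      hsub).const_mul hr).exp.const_mul
        (Real.exp_pos (-(r * stableLaplace β (Ioc (1 / ((k : ℝ) + 1)) S) 0))).le
    convert h using 2 with n
    rw [setIntegral_stableIntegrand hβ0 hk measurableSet_Ioc hsub (torusEigenvalue_nonneg n),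
      ← Complex.ofReal_mul, ← Complex.ofReal_exp, ← Complex.ofReal_mul, ← Real.exp_add]
    ring_nf
  · rw [Complex.norm_of_nonneg (Real.exp_pos _).le, Real.exp_le_one_iff, neg_nonpos]
    refine mul_nonneg hr (setIntegral_nonneg measurableSet_Ioc fun s hs => ?_)
    exact stableIntegrand_nonneg β (torusEigenvalue_nonneg n)
      ((by positivity : (0 : ℝ) < 1 / ((k : ℝ) + 1)).trans hs.1).le
  · have hU : ⋃ k : ℕ, Ioc (1 / ((k : ℝ) + 1)) S = Ioc 0 S := by
      ext s
      simp only [mem_iUnion, mem_Ioc]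
      constructor
      · rintro ⟨k, h1, h2⟩
        exact ⟨(by positivity : (0 : ℝ) < 1 / ((k : ℝ) + 1)).trans h1, h2⟩
      · rintro ⟨h1, h2⟩
        obtain ⟨k, hk⟩ := exists_nat_one_div_lt h1
        exact ⟨k, hk, h2⟩
    have h := tendsto_setIntegral_of_monotone (μ := volume)
      (f := stableIntegrand β (torusEigenvalue n))
      (s := fun k : ℕ => Ioc (1 / ((k : ℝ) + 1)) S) (fun k => measurableSet_Ioc)
      (fun j k hjk => Ioc_subset_Ioc_left (one_div_le_one_div_of_le (by positivity)
        (by gcongr)))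
      (by
        rw [hU]
        exact (integrableOn_stableIntegrand hβ0 hβ1 (torusEigenvalue_nonneg n)).mono_set
          Ioc_subset_Ioi_self)
    rw [hU] at h
    exact (Complex.continuous_ofReal.tendsto _).comp
      ((Real.continuous_exp.tendsto _).comp (h.const_mul r).neg)

lemma neg_tsum_norm_le_fourierRe {b : (Fin d → ℤ) → ℂ} (hb : Summable b) (x : Fin d → ℝ) :
    -∑' n, ‖b n‖ ≤ fourierRe b x := by
  have h := norm_tsum_le_tsum_norm (summable_mul_fchar hb x).norm
  simp only [norm_mul, norm_fchar, mul_one] at h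
  have h2 := Complex.abs_re_le_norm (∑' n, b n * fchar (∑ i, (n i : ℝ) * x i))
  exact (abs_le.1 (h2.trans h)).1

lemma summable_stableLaplace {β S : ℝ} (hβ : 0 < β) (hS : 0 < S) :
    Summable fun n : Fin d → ℤ =>
      ((stableLaplace β (Ioi S) (torusEigenvalue n) : ℝ) : ℂ) := by
  have h := summable_exp_neg_torusEigenvalue_rpow (d := d) hS one_pos
  simp only [Real.rpow_one] at h
  refine Summable.of_norm_bounded (h.mul_right (stableLaplace β (Ioi S) 0)) fun n => ?_
  rw [Complex.norm_of_nonneg (stableLaplace_nonneg hS measurableSet_Ioi subset_rfl _)]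
  exact stableLaplace_Ioi_le hβ hS (torusEigenvalue_nonneg n)

/-- The large jumps alone have a uniformly positive density on the torus. -/
lemma exists_le_fourierRe_stableLaplace (d : ℕ) {β : ℝ} (hβ : 0 < β) :
    ∃ S : ℝ, 0 < S ∧ ∀ x : Fin d → ℝ, stableLaplace β (Ioi S) 0 / 2 ≤
      fourierRe (fun n => ((stableLaplace β (Ioi S) (torusEigenvalue n) : ℝ) : ℂ)) x := by
  have hQ := summable_exp_neg_torusEigenvalue_rpow (d := d) one_pos one_pos
  simp only [Real.rpow_one, one_mul] at hQ
  obtain ⟨Q, hQdef⟩ : ∃ Q, Q = ∑' n : Fin d → ℤ, Real.exp (-torusEigenvalue n) := ⟨_, rfl⟩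
  have hlim : Tendsto (fun R : ℝ => Real.exp (-R) * Q) atTop (𝓝 0) := by
    simpa using (Real.tendsto_exp_neg_atTop_nhds_zero).mul_const Q
  obtain ⟨R, hR, hR0⟩ := ((hlim.eventually_le_const (by norm_num : (0 : ℝ) < 1 / 2)).and
    (eventually_ge_atTop 0)).exists
  have hS : 0 < R + 1 := by linarith
  refine ⟨R + 1, hS, fun x => ?_⟩
  have hm0 := stableLaplace_Ioi_zero_pos hβ hS
  obtain ⟨m, hm⟩ : ∃ m, m = stableLaplace β (Ioi (R + 1)) 0 := ⟨_, rfl⟩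
  rw [← hm] at hm0 ⊢
  have hg := summable_stableLaplace (d := d) hβ hS
  have hδ : Summable (fun n : Fin d → ℤ => if n = 0 then ((-m : ℝ) : ℂ) else 0) :=
    summable_of_ne_finset_zero (s := {0}) fun n hn => if_neg (by simpa using hn)
  have h1 := neg_tsum_norm_le_fourierRe (hg.add hδ) x
  rw [fourierRe_add hg hδ, fourierRe_ite_zero, Complex.ofReal_re] at h1
  have h2 : ∑' n : Fin d → ℤ, ‖((stableLaplace β (Ioi (R + 1)) (torusEigenvalue n) : ℝ) : ℂ) +
      (if n = 0 then ((-m : ℝ) : ℂ) else 0)‖ ≤ m * Real.exp (-R) * Q := by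
    rw [hQdef, ← tsum_mul_left]
    refine Summable.tsum_le_tsum (fun n => ?_) (summable_norm_iff.2 (hg.add hδ))
      (hQ.mul_left _)
    rcases eq_or_ne n 0 with rfl | hn
    · rw [torusEigenvalue_zero, ← hm]
      simp only [if_true, Complex.ofReal_neg, add_neg_cancel, norm_zero]
      positivity
    · rw [if_neg hn, add_zero, Complex.norm_of_nonneg
        (stableLaplace_nonneg hS measurableSet_Ioi subset_rfl _)]
      refine (stableLaplace_Ioi_le hβ hS (torusEigenvalue_nonneg n)).trans ?_
      rw [← hm, mul_comm, mul_assoc, ← Real.exp_add]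
      refine mul_le_mul_of_nonneg_left (Real.exp_le_exp.2 ?_) hm0.le
      nlinarith [one_le_torusEigenvalue hn]
  have h3 : m * Real.exp (-R) * Q ≤ m * (1 / 2) := by
    rw [mul_assoc]
    exact mul_le_mul_of_nonneg_left hR hm0.le
  linarith

end Levy

/-- short time lower bound for the periodic fractional heat kernel, 0 < α < 2. -/
theorem periodic_kernel_short_time_lower_bound
    (d : ℕ) (hd : 1 ≤ d) (α : ℝ) (hα0 : 0 < α) (hα2 : α < 2) :
    ∃ c₃ : ℝ, 0 < c₃ ∧
      ∀ t : ℝ, 0 < t → t ≤ 1 →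
      ∀ x : Fin d → ℝ, c₃ * t ≤ kper d α t x := by
  have hβ0 : 0 < α / 2 := by linarith
  have hβ1 : α / 2 < 1 := by linarith
  obtain ⟨β, hβ⟩ : ∃ β, β = α / 2 := ⟨_, rfl⟩
  rw [← hβ] at hβ0 hβ1
  obtain ⟨S, hS, hlow⟩ := exists_le_fourierRe_stableLaplace d hβ0
  have hm0 := stableLaplace_Ioi_zero_pos hβ0 hS
  have hJ0 := integral_stableIntegrand_one_pos hβ0 hβ1
  obtain ⟨m, hm⟩ : ∃ m, m = stableLaplace β (Set.Ioi S) 0 := ⟨_, rfl⟩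
  obtain ⟨J, hJ⟩ : ∃ J, J = ∫ s in Set.Ioi 0, stableIntegrand β 1 s := ⟨_, rfl⟩
  rw [← hm] at hm0 hlow
  rw [← hJ] at hJ0
  refine ⟨Real.exp (-(m / J)) * (m / (2 * J)), by positivity, fun t ht ht1 x => ?_⟩
  obtain ⟨g, hg⟩ : ∃ g : (Fin d → ℤ) → ℝ,
    g = fun n => stableLaplace β (Set.Ioi S) (torusEigenvalue n) := ⟨_, rfl⟩
  obtain ⟨ψ, hψ⟩ : ∃ ψ : (Fin d → ℤ) → ℝ,
    ψ = fun n => ∫ s in Set.Ioc 0 S, stableIntegrand β (torusEigenvalue n) s := ⟨_, rfl⟩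
  have hsplit : ∀ n, torusEigenvalue n ^ β * J = ψ n + (m - g n) := by
    intro n
    have hl := torusEigenvalue_nonneg n
    have hint := integrableOn_stableIntegrand hβ0 hβ1 hl
    rw [hJ, ← integral_stableIntegrand hβ0 hl, ← Set.Ioc_union_Ioi_eq_Ioi hS.le,
      setIntegral_union Set.Ioc_disjoint_Ioi_same measurableSet_Ioi
        (hint.mono_set Set.Ioc_subset_Ioi_self)
        (hint.mono_set (Set.Ioi_subset_Ioi hS.le)),
      setIntegral_stableIntegrand hβ0 hS measurableSet_Ioi subset_rfl hl, hψ, hg, hm]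
  have hr : 0 < t / J := by positivity
  obtain ⟨r, hrdef⟩ : ∃ r, r = t / J := ⟨_, rfl⟩
  rw [← hrdef] at hr
  have hexp : ∀ n, -(t * torusEigenvalue n ^ β) = -(r * ψ n) + -(r * m) + r * g n := by
    intro n
    have : t = r * J := by
      rw [hrdef]
      field_simp
    rw [this, mul_assoc, mul_comm J, hsplit]
    ring
  have hg0 : ∀ n, 0 ≤ g n := fun n => by
    rw [hg]
    exact stableLaplace_nonneg hS measurableSet_Ioi subset_rfl _
  have hgM : IsPosMultiplier (fun n => (g n : ℂ)) := by
    rw [hg]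
    exact isPosMultiplier_stableLaplace hβ0 hS measurableSet_Ioi subset_rfl
  have hgs : Summable (fun n => (g n : ℂ)) := by
    rw [hg]
    exact summable_stableLaplace hβ0 hS
  obtain ⟨a, ha⟩ : ∃ a : (Fin d → ℤ) → ℂ,
    a = fun n => ((Real.exp (-(r * ψ n)) : ℝ) : ℂ) := ⟨_, rfl⟩
  have haM : IsPosMultiplier a := by
    rw [ha, hψ]
    exact isPosMultiplier_exp_neg_setIntegral hβ0 hβ1 hr.le
  have ha0 : a 0 = 1 := by
    simp [ha, hψ, torusEigenvalue_zero, stableIntegrand]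
  have has : Summable a := by
    refine Summable.of_norm_bounded
      ((summable_exp_neg_torusEigenvalue_rpow (d := d) ht hβ0).mul_left (Real.exp (r * m)))
      fun n => ?_
    rw [ha, Complex.norm_of_nonneg (Real.exp_pos _).le, ← Real.exp_add, hexp]
    refine Real.exp_le_exp.2 ?_
    linarith [mul_nonneg hr.le (hg0 n)]
  have hRM := (hgM.const_mul hr.le).exp_sub_one_sub
  have hag : Summable (fun n => a n * (g n : ℂ)) := haM.summable_mul hgs
  have hrag : Summable (fun n => (r : ℂ) * (a n * (g n : ℂ))) := hag.mul_left _
  have hRa := hRM.summable_mul has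
  have hk : kper d α t x = Real.exp (-(r * m)) * (fourierRe a x +
      r * fourierRe (fun n => a n * (g n : ℂ)) x +
      fourierRe (fun n => (Complex.exp ((r : ℂ) * g n) - 1 - (r : ℂ) * g n) * a n) x) := by
    rw [← fourierRe_const_mul r, ← fourierRe_add has hrag, ← fourierRe_add (has.add hrag) hRa,
      ← fourierRe_const_mul]
    unfold kper fourierRe
    congr 2
    ext n
    congr 1
    rw [torusEigenvalue_rpow_half, ← hβ, neg_mul, hexp, Real.exp_add, Real.exp_add, ha]
    push_cast
    ring
  have h1 := haM.fourierRe_nonneg has x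
  have h2 := haM.le_fourierRe ha0 hgs (c := m / 2) (by rw [hg]; exact hlow) x
  have h3 := hRM.nonneg a has (haM.fourierRe_nonneg has) x
  have h4 : Real.exp (-(m / J)) ≤ Real.exp (-(r * m)) := by
    refine Real.exp_le_exp.2 (neg_le_neg ?_)
    rw [hrdef, div_mul_eq_mul_div]
    gcongr
    exact mul_le_of_le_one_left hm0.le ht1
  have h5 : r * (m / 2) ≤ r * fourierRe (fun n => a n * (g n : ℂ)) x :=
    mul_le_mul_of_nonneg_left h2 hr.le
  calc _ = Real.exp (-(m / J)) * (r * (m / 2)) := by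
        rw [hrdef]
        field_simp
    _ ≤ Real.exp (-(r * m)) * (r * (m / 2)) := by gcongr
    _ ≤ _ := by
        rw [hk]
        refine mul_le_mul_of_nonneg_left ?_ (Real.exp_pos _).le
        linarith

end
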